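/- Let n ≥ 2, let L = ℤ^n and Φ be the root system of type B_n with Weyl group W. An element w ∈ W is a strict quasi Coxeter element — i.e. the subroot lattice of every reduced presentation of w equals ℤ^n — if and only if w is a single negative cycle of length n (a Coxeter element of B_n). -/

import Mathlib

/-- The standard basis vector `e i` of `ℤ^m`. -/
def std (m : ℕ) (i : Fin m) : Fin m → ℤ := Pi.single i 1

/-- The root system of type `B_n`:
`{± e_i} ∪ {± e_i ± e_j | i < j}` in `ℤ^n`. -/
def PhiB (n : ℕ) : Set (Fin n → ℤ) :=
  {v | ∃ i : Fin n, v = std n i ∨ v = -std n i} ∪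
  {v | ∃ i j : Fin n, i ≠ j ∧
    (v = std n i - std n j ∨ v = std n i + std n j ∨ v = -(std n i + std n j))}

/-- The graph `G(A)` associated to a set `A` of roots of type `B_n`: vertices `1, …, n`,
with `i ≠ j` adjacent iff one of the roots `±(e_i - e_j)`, `±(e_i + e_j)` lies in `A`. -/
def GB (n : ℕ) (A : Set (Fin n → ℤ)) : SimpleGraph (Fin n) where
  Adj i j := i ≠ j ∧
    (std n i - std n j ∈ A ∨ std n j - std n i ∈ A ∨
     std n i + std n j ∈ A ∨ -(std n i + std n j) ∈ A)
  symm := by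
    refine ⟨?_⟩
    rintro i j ⟨h1, h2⟩
    refine ⟨h1.symm, ?_⟩
    rcases h2 with h | h | h | h
    · exact Or.inr (Or.inl h)
    · exact Or.inl h
    · refine Or.inr (Or.inr (Or.inl ?_)); rwa [add_comm]
    · refine Or.inr (Or.inr (Or.inr ?_)); rwa [add_comm]
  loopless := ⟨fun i h => h.1 rfl⟩

/-- The standard scalar product on `ℤ^m`. -/
def dotZ {m : ℕ} (x y : Fin m → ℤ) : ℤ := ∑ i, x i * y i

/-- The reflection `s_α : x ↦ x - (2(x,α)/(α,α)) • α` (the division is exact for every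
root `α` of the systems considered here, so this is the honest reflection). -/
def reflZ {m : ℕ} (α : Fin m → ℤ) (x : Fin m → ℤ) : Fin m → ℤ :=
  x - ((2 * dotZ x α) / dotZ α α) • α

/-- The signed permutation determined by `σ` and signs `ε`, i.e. the ℤ-linear map with
`w(e_i) = ε_i • e_{σ(i)}`. -/
def wSigned {n : ℕ} (σ : Equiv.Perm (Fin n)) (ε : Fin n → ℤ) :
    (Fin n → ℤ) → (Fin n → ℤ) :=
  fun x j => ε (σ⁻¹ j) * x (σ⁻¹ j)

/-- `(α_1, …, α_k)` is a presentation of `w`: all `α_i` are roots and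
`w = s_{α_1} ∘ ⋯ ∘ s_{α_k}`. -/
def IsPresZ {m : ℕ} (Φ : Set (Fin m → ℤ)) (w : (Fin m → ℤ) → (Fin m → ℤ))
    (l : List (Fin m → ℤ)) : Prop :=
  (∀ α ∈ l, α ∈ Φ) ∧ l.foldr (fun α f => reflZ α ∘ f) id = w

/-- The length `l(w)`: the minimal length of a presentation of `w`. -/
noncomputable def clen {m : ℕ} (Φ : Set (Fin m → ℤ))
    (w : (Fin m → ℤ) → (Fin m → ℤ)) : ℕ :=
  sInf {k | ∃ l, IsPresZ Φ w l ∧ l.length = k}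


lemma std_apply' {n : ℕ} (i k : Fin n) : std n i k = if k = i then 1 else 0 := by
  simp [std, Pi.single_apply]

lemma dot_std {n : ℕ} (x : Fin n → ℤ) (i : Fin n) : dotZ x (std n i) = x i := by
  simp [dotZ, std_apply']

lemma dot_long {n : ℕ} (x : Fin n → ℤ) (i j : Fin n) (d : ℤ) :
    dotZ x (std n i - d • std n j) = x i - d * x j := by
  simp only [dotZ, Pi.sub_apply, Pi.smul_apply, smul_eq_mul, mul_sub, Finset.sum_sub_distrib]
  have h1 := dot_std x i
  have h2 := dot_std x j
  simp only [dotZ] at h1 h2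
  rw [h1, ← h2, Finset.mul_sum]
  congr 1
  apply Finset.sum_congr rfl
  intros; ring

lemma refl_short {n : ℕ} (x : Fin n → ℤ) (i : Fin n) :
    reflZ (std n i) x = fun k => if k = i then - x i else x k := by
  funext k
  simp only [reflZ, dot_std, std_apply', Pi.sub_apply, Pi.smul_apply, smul_eq_mul]
  by_cases h : k = i
  · subst h; simp; ring
  · simp [h]

lemma refl_long {n : ℕ} (x : Fin n → ℤ) (i j : Fin n) (hij : i ≠ j) (d : ℤ)
    (hd : d = 1 ∨ d = -1) :
    reflZ (std n i - d • std n j) x =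
      fun k => if k = i then d * x j else if k = j then d * x i else x k := by
  have h2 : dotZ (std n i - d • std n j) (std n i - d • std n j) = 2 := by
    rw [dot_long]
    simp only [std_apply', Pi.sub_apply, Pi.smul_apply, smul_eq_mul]
    rcases hd with rfl | rfl <;> simp [hij, hij.symm]
  funext k
  simp only [reflZ, h2, dot_long]
  rw [Int.mul_ediv_cancel_left _ (by norm_num)]
  simp only [std_apply', Pi.sub_apply, Pi.smul_apply, smul_eq_mul]
  split_ifs with h h' h' <;> rcases hd with rfl | rfl <;> grind

lemma refl_neg {n : ℕ} (a : Fin n → ℤ) (ha : dotZ a a = 2) : reflZ (-a) = reflZ a := by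
  funext x
  have h1 : dotZ (-a) (-a) = 2 := by rw [← ha]; simp [dotZ]
  have h2 : dotZ x (-a) = - dotZ x a := by simp [dotZ]
  simp only [reflZ, h1, h2, ha]
  rw [Int.mul_ediv_cancel_left _ (by norm_num), Int.mul_ediv_cancel_left _ (by norm_num)]
  simp

lemma wS_eq_iff {n : ℕ} (σ : Equiv.Perm (Fin n)) (ε : Fin n → ℤ) (x y : Fin n → ℤ) :
    wSigned σ ε x = y ↔ ∀ k, y (σ k) = ε k * x k := by
  constructor
  · rintro rfl k
    simp [wSigned]
  · intro h
    funext j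
    have := h (σ⁻¹ j)
    simp only [wSigned]
    rw [← this]; simp

lemma wS_add {n : ℕ} (σ : Equiv.Perm (Fin n)) (ε : Fin n → ℤ) (x y : Fin n → ℤ) :
    wSigned σ ε (x + y) = wSigned σ ε x + wSigned σ ε y := by
  funext j; simp [wSigned, mul_add]

lemma wS_sub {n : ℕ} (σ : Equiv.Perm (Fin n)) (ε : Fin n → ℤ) (x y : Fin n → ℤ) :
    wSigned σ ε (x - y) = wSigned σ ε x - wSigned σ ε y := by
  funext j; simp [wSigned, mul_sub]

lemma wS_smul {n : ℕ} (σ : Equiv.Perm (Fin n)) (ε : Fin n → ℤ) (c : ℤ) (y : Fin n → ℤ) :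
    wSigned σ ε (c • y) = c • wSigned σ ε y := by
  funext j; simp [wSigned]; ring

lemma wS_std {n : ℕ} (σ : Equiv.Perm (Fin n)) (ε : Fin n → ℤ) (i : Fin n) :
    wSigned σ ε (std n i) = ε i • std n (σ i) := by
  rw [wS_eq_iff]
  intro k
  by_cases h : k = i <;> simp [std_apply', h]

lemma strip {n : ℕ} (v : Fin n → ℤ) (i0 : Fin n) (hv : v i0 ≠ 0) (T : Finset (Fin n)) :
    i0 ∉ T → ∀ (σ : Equiv.Perm (Fin n)) (ε : Fin n → ℤ), (∀ i, ε i = 1 ∨ ε i = -1) →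
    (∀ k, v (σ k) = ε k * v k) → (∀ k, k ∉ T → k ≠ i0 → σ k = k ∧ ε k = 1) →
    ∃ l, IsPresZ (PhiB n) (wSigned σ ε) l ∧ l.length ≤ T.card ∧ ∀ α ∈ l, dotZ v α = 0 := by
  induction T using Finset.induction_on with
  | empty =>
    intro _ σ ε hε hfix hk
    have h0 : σ i0 = i0 := by
      by_contra h
      have := (hk (σ i0) (by simp) h).1
      exact h (σ.injective this)
    have h1 : ε i0 = 1 := by
      have := hfix i0
      rw [h0] at this
      rcases hε i0 with h | h
      · exact h
      · rw [h] at this; omega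
    refine ⟨[], ⟨by simp, ?_⟩, by simp, by simp⟩
    symm
    simp only [List.foldr_nil]
    funext x
    rw [wS_eq_iff]
    intro k
    by_cases hki : k = i0
    · subst hki; simp [h0, h1]
    · simp [hk k (by simp) hki]
  | insert i T hiT ih =>
    intro hi0 σ ε hε hfix hk
    simp only [Finset.mem_insert, not_or] at hi0
    rw [Finset.card_insert_of_notMem hiT]
    by_cases hi : σ i = i
    · rcases hε i with h1 | h1
      · obtain ⟨l, a, b, c⟩ := ih hi0.2 σ ε hε hfix (by
          intro k hkT hki0
          by_cases hki : k = i
          · subst hki; exact ⟨hi, h1⟩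
          · exact hk k (by simp [hki, hkT]) hki0)
        exact ⟨l, a, by omega, c⟩
      · have hvi : v i = 0 := by
          have := hfix i
          rw [hi, h1] at this; omega
        obtain ⟨l, a, b, c⟩ := ih hi0.2 σ (fun k => if k = i then 1 else ε k)
          (by intro k; by_cases hki : k = i <;> simp [hki, hε k])
          (by
            intro k; by_cases hki : k = i
            · subst hki; simp [hi]
            · simp [hki, hfix k])
          (by
          intro k hkT hki0
          by_cases hki : k = i
          · subst hki; exact ⟨hi, by simp⟩
          · simp only [hki, if_false]; exact hk k (by simp [hki, hkT]) hki0)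
        refine ⟨std n i :: l, ⟨?_, ?_⟩, by simp; omega, ?_⟩
        · intro α hα
          rcases List.mem_cons.1 hα with rfl | hα
          · exact Or.inl ⟨i, Or.inl rfl⟩
          · exact a.1 α hα
        · rw [List.foldr_cons, a.2]
          symm
          funext x
          rw [wS_eq_iff]
          intro k
          simp only [Function.comp, refl_short]
          have e := (wS_eq_iff σ (fun k => if k = i then 1 else ε k) x _).1 rfl
          have ek := e k
          have ei := e i
          by_cases hki : k = i
          · subst hki
            rw [hi] at ei ⊢
            simp [ei, h1]
          · have : σ k ≠ i := fun h => hki (σ.injective (h.trans hi.symm))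
            simp only [this, if_false, ek, hki]
        · intro α hα
          rcases List.mem_cons.1 hα with rfl | hα
          · rw [dot_std, hvi]
          · exact c α hα
    · obtain ⟨j, hj⟩ : ∃ j, j = σ i := ⟨_, rfl⟩
      have hij : i ≠ j := fun h => hi (by rw [← hj, ← h])
      have hdd : ε i * ε i = 1 := by rcases hε i with h | h <;> simp [h]
      have hσ' : ∀ k, (Equiv.swap i j * σ) k = if k = i then i else if σ k = i then j else σ k := by
        intro k
        simp only [Equiv.Perm.mul_apply, Equiv.swap_apply_def]
        have : σ k = j ↔ k = i := by rw [hj]; exact σ.injective.eq_iff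
        by_cases hki : k = i
        · subst hki; simp [← hj, hij.symm]
        · simp [hki, this]
      set ε' : Fin n → ℤ := fun k => if k = i then 1 else if σ k = i then ε k * ε i else ε k
        with hε'
      obtain ⟨l, a, b, c⟩ := ih hi0.2 (Equiv.swap i j * σ) ε'
        (by
          intro k; simp only [hε']
          split_ifs
          · simp
          · rcases hε k with h | h <;> rcases hε i with h' | h' <;> simp [h, h']
          · exact hε k)
        (by
          intro k
          rw [hσ']; simp only [hε']
          split_ifs with h1 h2
          · rw [h1]; ring
          · rw [hj, hfix i, ← h2, hfix k, h2]; ring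
          · exact hfix k)
        (by
          intro k hkT hki0
          rw [hσ']; simp only [hε']
          split_ifs with h1 h2
          · exact ⟨h1.symm, rfl⟩
          · have := (hk k (by simp [h1, hkT]) hki0).1
            rw [h2] at this; exact absurd this.symm h1
          · exact hk k (by simp [h1, hkT]) hki0)
      refine ⟨(std n i - ε i • std n j) :: l, ⟨?_, ?_⟩, by simp; omega, ?_⟩
      · intro α hα
        rcases List.mem_cons.1 hα with rfl | hα
        · refine Or.inr ⟨i, j, hij, ?_⟩
          rcases hε i with h | h <;> simp [h]
        · exact a.1 α hα
      · rw [List.foldr_cons, a.2]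
        symm
        funext x
        rw [wS_eq_iff]
        intro k
        simp only [Function.comp]
        rw [refl_long _ _ _ hij _ (hε i)]
        have e := (wS_eq_iff (Equiv.swap i j * σ) ε' x _).1 rfl
        set y := wSigned (Equiv.swap i j * σ) ε' x with hy
        have ek := e k
        have ei := e i
        rw [hσ'] at ek ei
        simp only [hε', if_true] at ek ei
        have hkj : σ k = j ↔ k = i := by rw [hj]; exact σ.injective.eq_iff
        by_cases hki : k = i
        · subst hki
          rw [← hj]
          simp [hij.symm, ei]
        · by_cases h2 : σ k = i
          · simp only [hki, h2, if_true, if_false] at ek ⊢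
            rw [ek]
            linear_combination (ε k * x k) * hdd
          · simp only [hki, h2, hkj, if_false] at ek ⊢
            exact ek
      · intro α hα
        rcases List.mem_cons.1 hα with rfl | hα
        · rw [dot_long, hj, hfix i]; linear_combination (-v i) * hdd
        · exact c α hα

lemma wS_iter {n : ℕ} (σ : Equiv.Perm (Fin n)) (ε : Fin n → ℤ)
    (hε : ∀ i, ε i = 1 ∨ ε i = -1) (i : Fin n) (m : ℕ) :
    ∃ c : ℤ, (c = 1 ∨ c = -1) ∧ (wSigned σ ε)^[m] (std n i) = c • std n ((σ ^ m) i) := by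
  induction m with
  | zero => exact ⟨1, Or.inl rfl, by simp⟩
  | succ m ih =>
    obtain ⟨c, hc, h⟩ := ih
    refine ⟨c * ε ((σ ^ m) i), ?_, ?_⟩
    · rcases hc with rfl | rfl <;> rcases hε ((σ ^ m) i) with h' | h' <;> simp [h']
    · rw [Function.iterate_succ_apply', h, wS_smul, wS_std, smul_smul, pow_succ']
      rfl

lemma wS_orbit_sum {n : ℕ} (σ : Equiv.Perm (Fin n)) (ε : Fin n → ℤ) (e : Fin n → ℤ) (N : ℕ) :
    wSigned σ ε (∑ m ∈ Finset.range N, (wSigned σ ε)^[m] e) =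
      (∑ m ∈ Finset.range N, (wSigned σ ε)^[m] e) - e + (wSigned σ ε)^[N] e := by
  induction N with
  | zero => funext j; simp [wSigned]
  | succ N ih =>
    rw [Finset.sum_range_succ, wS_add, ih, ← Function.iterate_succ_apply' (wSigned σ ε)]
    abel

/-- The orbit sum of `e_i`. -/
lemma orbit {n : ℕ} (σ : Equiv.Perm (Fin n)) (ε : Fin n → ℤ)
    (hε : ∀ i, ε i = 1 ∨ ε i = -1) (i : Fin n) :
    ∃ u : Fin n → ℤ, u i = 1 ∧ (∀ j, ¬ σ.SameCycle i j → u j = 0) ∧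
      (wSigned σ ε u = u ∨ (wSigned σ ε u = u - (2 : ℤ) • std n i ∧
        ∃ k : ℕ, 0 < k ∧ (wSigned σ ε)^[k] (std n i) = -std n i)) := by
  classical
  have hex : ∃ k : ℕ, 0 < k ∧ (σ ^ k) i = i :=
    ⟨orderOf σ, orderOf_pos σ, by simp [pow_orderOf_eq_one]⟩
  obtain ⟨N, ⟨hN, hNi⟩, hmin⟩ : ∃ N, (0 < N ∧ (σ ^ N) i = i) ∧
      ∀ m < N, ¬ (0 < m ∧ (σ ^ m) i = i) :=
    ⟨Nat.find hex, Nat.find_spec hex, fun m hm => Nat.find_min hex hm⟩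
  refine ⟨∑ m ∈ Finset.range N, (wSigned σ ε)^[m] (std n i), ?_, ?_, ?_⟩
  · rw [Finset.sum_apply, Finset.sum_eq_single 0]
    · simp [std_apply']
    · intro m hm hm0
      obtain ⟨c, -, h⟩ := wS_iter σ ε hε i m
      have := hmin m (Finset.mem_range.1 hm)
      have h2 : i ≠ (σ ^ m) i := fun h => this ⟨Nat.pos_of_ne_zero hm0, h.symm⟩
      rw [h]; simp [std_apply', h2]
    · intro h; simp at h; omega
  · intro j hj
    rw [Finset.sum_apply]
    apply Finset.sum_eq_zero
    intro m _
    obtain ⟨c, -, h⟩ := wS_iter σ ε hε i m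
    have h2 : j ≠ (σ ^ m) i := by
      rintro rfl
      exact hj ⟨m, by simp⟩
    rw [h]; simp [std_apply', h2]
  · rw [wS_orbit_sum]
    obtain ⟨c, hc, h⟩ := wS_iter σ ε hε i N
    rw [hNi] at h
    rcases hc with rfl | rfl
    · left; rw [h]; simp
    · right
      have h' : (wSigned σ ε)^[N] (std n i) = -std n i := by rw [h]; simp
      refine ⟨?_, N, hN, h'⟩
      rw [h', two_smul]; abel

lemma fixed_contra {n : ℕ} (σ : Equiv.Perm (Fin n)) (ε : Fin n → ℤ)
    (hε : ∀ i, ε i = 1 ∨ ε i = -1) (u : Fin n → ℤ) (i : Fin n) (hu : u i = 1)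
    (hw : wSigned σ ε u = u) (k : ℕ) (hk : (wSigned σ ε)^[k] (std n i) = -std n i) : False := by
  have key : ∀ x, dotZ u (wSigned σ ε x) = dotZ u x := by
    intro x
    have h1 := (wS_eq_iff σ ε u u).1 hw
    have h2 := (wS_eq_iff σ ε x _).1 rfl
    simp only [dotZ]
    rw [← Equiv.sum_comp σ]
    apply Finset.sum_congr rfl
    intro m _
    rw [h1, h2]
    rcases hε m with h | h <;> rw [h] <;> ring
  have key2 : ∀ k x, dotZ u ((wSigned σ ε)^[k] x) = dotZ u x := by
    intro k
    induction k with
    | zero => intro x; rfl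
    | succ k ih => intro x; rw [Function.iterate_succ_apply, ih, key]
  have h := key2 k (std n i)
  rw [hk, dot_std] at h
  have : dotZ u (-std n i) = - dotZ u (std n i) := by simp [dotZ]
  rw [this, dot_std, hu] at h
  omega

lemma fold_sub_mem {n : ℕ} (l : List (Fin n → ℤ)) (x : Fin n → ℤ) :
    l.foldr (fun α f => reflZ α ∘ f) id x - x ∈ Submodule.span ℤ {α | α ∈ l} := by
  induction l with
  | nil => simp
  | cons a l ih =>
    rw [List.foldr_cons]
    have hle : Submodule.span ℤ {α | α ∈ l} ≤ Submodule.span ℤ {α | α ∈ a :: l} :=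
      Submodule.span_mono (fun x hx => List.mem_cons_of_mem _ hx)
    have ha : a ∈ Submodule.span ℤ {α | α ∈ a :: l} :=
      Submodule.subset_span (by simp)
    set y := l.foldr (fun α f => reflZ α ∘ f) id x with hy
    have : (reflZ a ∘ l.foldr (fun α f => reflZ α ∘ f) id) x - x =
        (y - x) - ((2 * dotZ y a) / dotZ a a) • a := by
      simp only [Function.comp, ← hy, reflZ]; abel
    rw [this]
    exact sub_mem (hle ih) (Submodule.smul_mem _ _ ha)

/-- long roots preserve the coordinate sum mod 4 on all-odd vectors -/
lemma long_parity {n : ℕ} (x : Fin n → ℤ) (hx : ∀ k, Odd (x k)) (i j : Fin n) (hij : i ≠ j)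
    (d : ℤ) (hd : d = 1 ∨ d = -1) :
    (∀ k, Odd (reflZ (std n i - d • std n j) x k)) ∧
      (4 : ℤ) ∣ (∑ k, reflZ (std n i - d • std n j) x k) - ∑ k, x k := by
  rw [refl_long _ _ _ hij _ hd]
  constructor
  · intro k
    have hdo : Odd d := by rcases hd with rfl | rfl <;> decide
    dsimp only
    split_ifs
    · exact hdo.mul (hx j)
    · exact hdo.mul (hx i)
    · exact hx k
  · rw [← Finset.sum_sub_distrib]
    have : ∀ k, (if k = i then d * x j else if k = j then d * x i else x k) - x k =
        (if k = i then d * x j - x i else 0) + (if k = j then d * x i - x j else 0) := by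
      intro k
      by_cases h : k = i
      · subst h; simp [hij]
      · by_cases h' : k = j
        · subst h'; simp [h]
        · simp [h, h']
    simp only [this, Finset.sum_add_distrib, Finset.sum_ite_eq', Finset.mem_univ, if_true]
    obtain ⟨p, hp⟩ := hx i
    obtain ⟨q, hq⟩ := hx j
    rcases hd with rfl | rfl
    · exact ⟨0, by ring⟩
    · exact ⟨-(p + q + 1), by rw [hp, hq]; ring⟩

lemma fold_parity {n : ℕ} (l : List (Fin n → ℤ)) (hl : ∀ α ∈ l, α ∈ PhiB n)
    (hs : ∀ i, std n i ∉ l ∧ -std n i ∉ l) (x : Fin n → ℤ) (hx : ∀ k, Odd (x k)) :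
    (∀ k, Odd (l.foldr (fun α f => reflZ α ∘ f) id x k)) ∧
      (4 : ℤ) ∣ (∑ k, l.foldr (fun α f => reflZ α ∘ f) id x k) - ∑ k, x k := by
  induction l with
  | nil => simpa using hx
  | cons a l ih =>
    obtain ⟨h1, h2⟩ := ih (fun α hα => hl α (List.mem_cons_of_mem _ hα))
      (fun i => ⟨fun h => (hs i).1 (List.mem_cons_of_mem _ h),
        fun h => (hs i).2 (List.mem_cons_of_mem _ h)⟩)
    rw [List.foldr_cons]
    simp only [Function.comp]
    set y := l.foldr (fun α f => reflZ α ∘ f) id x with hy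
    have main : (∀ k, Odd (reflZ a y k)) ∧ (4 : ℤ) ∣ (∑ k, reflZ a y k) - ∑ k, y k := by
      rcases hl a (by simp) with ⟨i, h | h⟩ | ⟨i, j, hij, h | h | h⟩
      · exact absurd (by simp [h]) (hs i).1
      · exact absurd (by simp [h]) (hs i).2
      · have := long_parity y h1 i j hij 1 (Or.inl rfl)
        rwa [one_smul, ← h] at this
      · have := long_parity y h1 i j hij (-1) (Or.inr rfl)
        rwa [neg_one_smul, sub_neg_eq_add, ← h] at this
      · have := long_parity y h1 i j hij (-1) (Or.inr rfl)
        have h2 : dotZ (std n i + std n j) (std n i + std n j) = 2 := by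
          have h3 := dot_long (std n i + std n j) i j (-1)
          rw [neg_one_smul, sub_neg_eq_add] at h3
          rw [h3]; simp [std_apply', hij, hij.symm]
        rwa [neg_one_smul, sub_neg_eq_add, ← refl_neg _ h2, ← h] at this
    refine ⟨main.1, ?_⟩
    have := dvd_add main.2 h2
    simpa using this

lemma span_short {n : ℕ} (l : List (Fin n → ℤ)) (hl : l.length < n) :
    Submodule.span ℤ {α | α ∈ l} ≠ ⊤ := by
  classical
  intro h
  have h1 := finrank_span_finset_le_card (R := ℤ) l.toFinset
  have h2 : ((l.toFinset : Finset (Fin n → ℤ)) : Set (Fin n → ℤ)) = {α | α ∈ l} := by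
    ext; simp
  rw [Set.finrank, h2, h, finrank_top] at h1
  simp at h1
  have := l.toFinset_card_le
  omega

lemma forward_aux {n : ℕ} (w : (Fin n → ℤ) → (Fin n → ℤ))
    (H : ∀ l : List (Fin n → ℤ), IsPresZ (PhiB n) w l →
        l.length = clen (PhiB n) w → Submodule.span ℤ {α | α ∈ l} = ⊤)
    (l : List (Fin n → ℤ)) (hp : IsPresZ (PhiB n) w l) (hlen : l.length ≤ n) :
    Submodule.span ℤ {α | α ∈ l} = ⊤ := by
  have hne : {k | ∃ l, IsPresZ (PhiB n) w l ∧ l.length = k}.Nonempty := ⟨_, l, hp, rfl⟩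
  obtain ⟨l', hp', hl'⟩ := Nat.sInf_mem hne
  have hle : clen (PhiB n) w ≤ l.length := Nat.sInf_le ⟨l, hp, rfl⟩
  have h' := H l' hp' hl'
  have : ¬ l'.length < n := fun h => span_short l' h h'
  apply H l hp
  have : l'.length = clen (PhiB n) w := hl'
  omega

lemma dot_even_of_span {n : ℕ} (v : Fin n → ℤ) (l : List (Fin n → ℤ))
    (hl : ∀ α ∈ l, (2 : ℤ) ∣ dotZ v α) (hs : Submodule.span ℤ {α | α ∈ l} = ⊤) (i : Fin n) :
    (2 : ℤ) ∣ v i := by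
  have : ∀ x ∈ Submodule.span ℤ {α | α ∈ l}, (2 : ℤ) ∣ dotZ v x := by
    intro x hx
    induction hx using Submodule.span_induction with
    | mem x h => exact hl x h
    | zero => simp [dotZ]
    | add x y _ _ h1 h2 =>
      have : dotZ v (x + y) = dotZ v x + dotZ v y := by
        simp [dotZ, mul_add, Finset.sum_add_distrib]
      rw [this]; exact dvd_add h1 h2
    | smul a x _ h =>
      have : dotZ v (a • x) = a * dotZ v x := by
        simp only [dotZ, Finset.mul_sum, Pi.smul_apply, smul_eq_mul]
        apply Finset.sum_congr rfl
        intros; ring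
      rw [this]; exact Dvd.dvd.mul_left h a
  have h := this (std n i) (by rw [hs]; trivial)
  rwa [dot_std] at h

lemma strip_all {n : ℕ} (v : Fin n → ℤ) (i0 : Fin n) (hv : v i0 = 1)
    (σ : Equiv.Perm (Fin n)) (ε : Fin n → ℤ) (hε : ∀ i, ε i = 1 ∨ ε i = -1)
    (hfix : wSigned σ ε v = v) :
    ∃ l, IsPresZ (PhiB n) (wSigned σ ε) l ∧ l.length + 1 ≤ n ∧ ∀ α ∈ l, dotZ v α = 0 := by
  obtain ⟨l, a, b, c⟩ := strip v i0 (by omega) (Finset.univ.erase i0) (by simp) σ ε hε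
    ((wS_eq_iff _ _ _ _).1 hfix) (by intro k h h'; simp [h'] at h)
  refine ⟨l, a, ?_, c⟩
  have := i0.pos
  rw [Finset.card_erase_of_mem (by simp)] at b
  simp at b
  omega

/-- composing with the reflection in `e_i - e_j` -/
lemma refl_comp {n : ℕ} (σ : Equiv.Perm (Fin n)) (ε : Fin n → ℤ) (i j : Fin n) (hij : i ≠ j) :
    reflZ (std n i - std n j) ∘ wSigned σ ε = wSigned (Equiv.swap i j * σ) ε := by
  symm
  funext x
  rw [wS_eq_iff]
  intro k
  have e := (wS_eq_iff σ ε x _).1 rfl k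
  have := refl_long (wSigned σ ε x) i j hij 1 (Or.inl rfl)
  rw [one_smul] at this
  simp only [Function.comp, this, one_mul, Equiv.Perm.mul_apply, Equiv.swap_apply_def]
  split_ifs <;> simp_all

lemma refl_invol {n : ℕ} (i j : Fin n) (hij : i ≠ j) (x : Fin n → ℤ) :
    reflZ (std n i - std n j) (reflZ (std n i - std n j) x) = x := by
  have h := fun x => refl_long (n := n) x i j hij 1 (Or.inl rfl)
  simp only [one_smul] at h
  rw [h, h]
  funext k
  simp only [one_mul]
  split_ifs <;> simp_all

theorem stmt15 (n : ℕ) (hn : 2 ≤ n) (σ : Equiv.Perm (Fin n)) (ε : Fin n → ℤ)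
    (hε : ∀ i, ε i = 1 ∨ ε i = -1) :
    (∀ l : List (Fin n → ℤ), IsPresZ (PhiB n) (wSigned σ ε) l →
        l.length = clen (PhiB n) (wSigned σ ε) →
        Submodule.span ℤ {α | α ∈ l} = ⊤) ↔
    (σ.IsCycle ∧ σ.support.card = n ∧
      ∀ i : Fin n, ∃ k : ℕ, 0 < k ∧ (wSigned σ ε)^[k] (std n i) = -std n i) := by
  constructor
  · intro H
    have nofix : ∀ i (u : Fin n → ℤ), u i = 1 → wSigned σ ε u ≠ u := by
      intro i u hu hw
      obtain ⟨l, a, b, c⟩ := strip_all u i hu σ ε hε hw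
      have := forward_aux _ H l a (by omega)
      exact span_short l (by omega) this
    have hall : ∀ i j, σ.SameCycle i j := by
      intro i j
      by_contra hS
      have hij : i ≠ j := by rintro rfl; exact hS (Equiv.Perm.SameCycle.refl _ _)
      obtain ⟨u, hu, hu0, hw⟩ := orbit σ ε hε i
      obtain ⟨u', hu', hu0', hw'⟩ := orbit σ ε hε j
      have hw := (hw.resolve_left (nofix i u hu)).1
      have hw' := (hw'.resolve_left (nofix j u' hu')).1
      have hj := hu0 j hS
      have hi := hu0' i (fun h => hS h.symm)
      have hvi : (u - u') i = 1 := by simp [hu, hi]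
      have hvj : (u - u') j = -1 := by simp [hu', hj]
      have hdot : dotZ (u - u') (std n i - std n j) = 2 := by
        have := dot_long (u - u') i j 1
        rw [one_smul] at this
        rw [this, hvi, hvj]; norm_num
      have hwv : wSigned σ ε (u - u') = reflZ (std n i - std n j) (u - u') := by
        have h2 := dot_long (std n i - std n j) i j 1
        have h3 : dotZ (std n i - std n j) (std n i - std n j) = 2 := by
          rw [one_smul] at h2
          rw [h2]; simp [std_apply', hij, hij.symm]
        rw [wS_sub, hw, hw']
        simp only [reflZ, hdot, h3]
        norm_num
        funext k
        simp
        ring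
      have hfix : wSigned (Equiv.swap i j * σ) ε (u - u') = u - u' := by
        rw [← refl_comp _ _ _ _ hij, Function.comp, hwv, refl_invol i j hij]
      obtain ⟨l, a, b, c⟩ := strip_all (u - u') i hvi _ ε hε hfix
      have hp : IsPresZ (PhiB n) (wSigned σ ε) ((std n i - std n j) :: l) := by
        constructor
        · intro α hα
          rcases List.mem_cons.1 hα with rfl | hα
          · exact Or.inr ⟨i, j, hij, Or.inl rfl⟩
          · exact a.1 α hα
        · rw [List.foldr_cons, a.2, ← refl_comp _ _ _ _ hij]
          funext x
          simp only [Function.comp]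
          exact refl_invol i j hij _
      have hs := forward_aux _ H _ hp (by simpa using b)
      have := dot_even_of_span (u - u') _ (by
        intro α hα
        rcases List.mem_cons.1 hα with rfl | hα
        · rw [hdot]
        · rw [c α hα]; exact dvd_zero _) hs i
      rw [hvi] at this
      omega
    have hmove : ∀ x, σ x ≠ x := by
      intro x hx
      have : Nontrivial (Fin n) := Fin.nontrivial_iff_two_le.2 hn
      obtain ⟨y, hy⟩ := exists_ne x
      obtain ⟨m, hm⟩ := hall x y
      rw [Equiv.Perm.zpow_apply_eq_self_of_apply_eq_self hx] at hm
      exact hy hm.symm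
    refine ⟨⟨⟨0, by omega⟩, hmove _, fun y _ => hall _ y⟩, ?_, ?_⟩
    · have : σ.support = Finset.univ := by ext x; simp [hmove x]
      rw [this]; simp
    · intro i
      obtain ⟨u, hu, -, hw⟩ := orbit σ ε hε i
      exact (hw.resolve_left (nofix i u hu)).2
  · rintro ⟨hc, hcard, hneg⟩ l hp -
    have hsupp : σ.support = Finset.univ := by
      rw [← Finset.card_eq_iff_eq_univ, hcard]; simp
    have hmove : ∀ x, σ x ≠ x := by
      intro x
      have : x ∈ σ.support := by rw [hsupp]; simp
      exact Equiv.Perm.mem_support.1 this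
    have hall : ∀ i j, σ.SameCycle i j := fun i j => hc.sameCycle (hmove i) (hmove j)
    -- propagate a σ-invariant property
    have prop : ∀ P : Fin n → Prop, (∀ k, P k ↔ P (σ k)) → ∀ i, P i → ∀ j, P j := by
      intro P hP i hi j
      obtain ⟨m, -, hm⟩ := (hall i j).exists_pow_eq'
      have : ∀ m : ℕ, P ((σ ^ m) i) := by
        intro m
        induction m with
        | zero => simpa using hi
        | succ m ih =>
          rw [pow_succ']
          exact (hP _).1 ih
      rw [← hm]; exact this m
    -- a short root exists
    have hshort : ∃ i, std n i ∈ l ∨ -std n i ∈ l := by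
      by_contra hno
      push Not at hno
      have i : Fin n := ⟨0, by omega⟩
      obtain ⟨u, hu, -, hw⟩ := orbit σ ε hε i
      obtain ⟨k, -, hk⟩ := hneg i
      have hw := (hw.resolve_left (fun h => fixed_contra σ ε hε u i hu h k hk)).1
      have hodd : ∀ j, Odd (u j) := by
        apply prop (fun j => Odd (u j)) _ i (by simp [hu])
        intro k
        have h := (wS_eq_iff σ ε u _).1 hw k
        simp only [Pi.sub_apply, Pi.smul_apply, smul_eq_mul] at h
        rcases hε k with h' | h' <;> rw [h'] at h <;>
          simp only [Int.odd_iff] <;> omega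
      have h4 := (fold_parity l hp.1 hno u hodd).2
      rw [hp.2, hw] at h4
      have h5 : ∑ k, (u - (2 : ℤ) • std n i) k - ∑ k, u k = -2 := by
        simp [std_apply', Finset.sum_sub_distrib]
      rw [h5] at h4
      omega
    obtain ⟨i, hi⟩ := hshort
    have hmem : std n i ∈ Submodule.span ℤ {α | α ∈ l} := by
      rcases hi with h | h
      · exact Submodule.subset_span h
      · have : -std n i ∈ Submodule.span ℤ {α | α ∈ l} := Submodule.subset_span h
        simpa using this
    have hallmem := prop (fun j => std n j ∈ Submodule.span ℤ {α | α ∈ l}) (by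
      intro k
      have h := fold_sub_mem l (std n k)
      rw [hp.2, wS_std] at h
      rcases hε k with h' | h'
      · rw [h', one_smul] at h
        constructor
        · intro hk; simpa using add_mem h hk
        · intro hk; simpa using sub_mem hk h
      · rw [h', neg_one_smul] at h
        constructor
        · intro hk; simpa using neg_mem (add_mem h hk)
        · intro hk; simpa using neg_mem (add_mem h hk)) i hmem
    rw [eq_top_iff]
    intro x _
    have : x = ∑ j, x j • std n j := by
      funext k
      simp [std_apply']
    rw [this]
    exact Submodule.sum_mem _ (fun j _ => Submodule.smul_mem _ _ (hallmem j))
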